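/- Let (W,S) be a finite Coxeter system. For every subset J of the set S of simple reflections and for every integer k ≥ 1, the number of strict k-chains u₁ < u₂ < … < u_k whose top element u_k has support equal to J is the same for the shard order ≤_σ on W as for the BHZ order ≤_β on W. -/

import Mathlib

open scoped Classical

namespace ShardBHZ

variable {B : Type*} {W : Type*} [Group W] {M : CoxeterMatrix B} (cs : CoxeterSystem M W)

/-- The support `S(w)` of `w`: the set of simple reflections appearing in some
(equivalently, any) reduced word for `w`. -/
def supp (w : W) : Set B := {i | ∃ l : List B, cs.IsReduced l ∧ cs.wordProd l = w ∧ i ∈ l}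

/-- The standard parabolic subgroup `W_I` generated by the simple reflections in `I`. -/
def parab (I : Set B) : Subgroup W := Subgroup.closure (cs.simple '' I)

/-- `x` has no right descent in `I`; this characterizes the minimal length coset
representatives `W^I` of `W / W_I`. -/
def IsMinRep (I : Set B) (x : W) : Prop := ∀ i ∈ I, ¬ cs.IsRightDescent x i

/-- The BHZ order: `u ≤_β v` iff the parabolic component `v_{S(u)}` equals `u`, i.e.
`v = (v * u⁻¹) * u` is the parabolic factorization of `v` with respect to `W_{S(u)}`:
`u ∈ W_{S(u)}`, `v * u⁻¹` has no right descent in `S(u)`, and lengths add. -/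
def bhzLE (u v : W) : Prop :=
  u ∈ parab cs (supp cs u) ∧ IsMinRep cs (supp cs u) (v * u⁻¹) ∧
    cs.length v = cs.length (v * u⁻¹) + cs.length u

/-- The set `N(w)` of left inversions of `w`. -/
def invSet (w : W) : Set W := {t | cs.IsLeftInversion w t}

/-- The subgroup `G(w)` generated by `w * s * w⁻¹` for `s` a right descent of `w`. -/
def descConj (w : W) : Subgroup W :=
  Subgroup.closure {x | ∃ i, cs.IsRightDescent w i ∧ x = w * cs.simple i * w⁻¹}

/-- The shard intersection order: `u ≤_σ v` iff `N(u) ⊆ N(v)` and `G(u) ⊆ G(v)`. -/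
def shardLE (u v : W) : Prop := invSet cs u ⊆ invSet cs v ∧ descConj cs u ≤ descConj cs v

section InversionParity

/-- The action of a simple reflection on pairs `(t, ε)`: conjugate `t`, and change the sign `ε`
when `t` is the simple reflection itself. -/
noncomputable def signedConj (i : B) : Function.End (W × ZMod 2) := fun p =>
  (cs.simple i * p.1 * cs.simple i, p.2 + if p.1 = cs.simple i then 1 else 0)

theorem signedConj_mul_pow_apply (i j : B) (n : ℕ) (t : W) (e : ZMod 2) :
    ((signedConj cs i * signedConj cs j) ^ n) (t, e) =
      ((cs.simple i * cs.simple j) ^ n * t * ((cs.simple i * cs.simple j) ^ n)⁻¹,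
        e + ∑ k ∈ Finset.range (2 * n),
          if t = ((cs.simple i * cs.simple j) ^ k)⁻¹ * cs.simple j then 1 else 0) := by
  have hcomm (k : ℕ) : cs.simple j * (cs.simple i * cs.simple j) ^ k =
      ((cs.simple i * cs.simple j) ^ k)⁻¹ * cs.simple j := by
    induction k with
    | zero => simp
    | succ k ih =>
      rw [pow_succ, ← mul_assoc, ih, ← pow_succ, pow_succ']
      simp [mul_assoc]
  induction n with
  | zero => simp; rfl
  | succ n ih =>
    rw [pow_succ']
    change signedConj cs i (signedConj cs j (((signedConj cs i * signedConj cs j) ^ n) (t, e))) = _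
    rw [ih]
    set c := cs.simple i * cs.simple j with hc
    have h1 : (c ^ n * t * (c ^ n)⁻¹ = cs.simple j) ↔
        t = (c ^ (2 * n))⁻¹ * cs.simple j := by
      rw [two_mul, pow_add, mul_inv_rev, mul_assoc _ _ (cs.simple j), ← hcomm n]
      rw [mul_inv_eq_iff_eq_mul, ← eq_inv_mul_iff_mul_eq]
    have h2 : (cs.simple j * (c ^ n * t * (c ^ n)⁻¹) * cs.simple j = cs.simple i) ↔
        t = (c ^ (2 * n + 1))⁻¹ * cs.simple j := by
      have e1 : (c ^ (2 * n + 1))⁻¹ * cs.simple j =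
          (c ^ n)⁻¹ * (cs.simple j * cs.simple i * cs.simple j) * c ^ n := by
        have : cs.simple j * cs.simple i * cs.simple j * c ^ n =
            (c ^ (n + 1))⁻¹ * cs.simple j := by
          rw [← hcomm, pow_succ', hc]; simp [mul_assoc]
        rw [mul_assoc, this, ← mul_assoc, ← mul_inv_rev, ← pow_add]
        congr 3; omega
      rw [e1]
      constructor
      · intro h
        rw [← h]; simp [mul_assoc]
      · intro h
        rw [h]; simp [mul_assoc]
    simp only [signedConj, Prod.mk.injEq]
    constructor
    · rw [pow_succ', hc]; simp [mul_assoc]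
    · rw [show 2 * (n + 1) = 2 * n + 1 + 1 by ring, Finset.sum_range_succ, Finset.sum_range_succ]
      simp only [h1, h2]
      ring

theorem isLiftable_signedConj : M.IsLiftable (signedConj cs) := by
  intro i j
  refine funext fun ⟨t, e⟩ => ?_
  rw [signedConj_mul_pow_apply, cs.simple_mul_simple_pow, two_mul, Finset.sum_range_add]
  simp only [pow_add, cs.simple_mul_simple_pow, one_mul, ← two_mul]
  have : (2 : ZMod 2) = 0 := rfl
  simp [this]; rfl

/-- The parity with which `t` occurs in the right inversion sequence of any word for `w`. -/
noncomputable def invParity (w t : W) : ZMod 2 := (cs.lift ⟨_, isLiftable_signedConj cs⟩ w (t, 0)).2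

theorem lift_signedConj_apply (w t : W) (e : ZMod 2) :
    cs.lift ⟨_, isLiftable_signedConj cs⟩ w (t, e) = (w * t * w⁻¹, e + invParity cs w t) := by
  induction w using cs.simple_induction_left generalizing t e with
  | one =>
    have h (p) : cs.lift ⟨_, isLiftable_signedConj cs⟩ 1 p = p := by rw [map_one]; rfl
    simp [invParity, h]
  | mul_simple_left w i ih =>
    have h (p) : cs.lift ⟨_, isLiftable_signedConj cs⟩ (cs.simple i * w) p =
        signedConj cs i (cs.lift ⟨_, isLiftable_signedConj cs⟩ w p) := by
      rw [map_mul, cs.lift_apply_simple]; rfl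
    have h0 : invParity cs (cs.simple i * w) t =
        invParity cs w t + if w * t * w⁻¹ = cs.simple i then 1 else 0 := by
      rw [invParity, h, ih, zero_add]; rfl
    rw [h, ih, h0]
    simp [signedConj, mul_assoc, add_assoc]

theorem invParity_mul (u v t : W) :
    invParity cs (u * v) t = invParity cs v t + invParity cs u (v * t * v⁻¹) := by
  have h : cs.lift ⟨_, isLiftable_signedConj cs⟩ (u * v) (t, 0) =
      cs.lift ⟨_, isLiftable_signedConj cs⟩ u (cs.lift ⟨_, isLiftable_signedConj cs⟩ v (t, 0)) := by
    rw [map_mul]; rfl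
  simp only [lift_signedConj_apply, Prod.mk.injEq] at h
  simpa using h.2

theorem invParity_one (t : W) : invParity cs 1 t = 0 := by
  simpa using invParity_mul cs 1 1 t

theorem invParity_simple (i : B) (t : W) :
    invParity cs (cs.simple i) t = if t = cs.simple i then 1 else 0 := by
  simp [invParity, signedConj]

theorem mem_rightInvSeq_of_invParity {l : List B} {t : W}
    (h : invParity cs (cs.wordProd l) t ≠ 0) : t ∈ cs.rightInvSeq l := by
  induction l with
  | nil => simp [invParity_one] at h
  | cons i l ih =>
    rw [CoxeterSystem.rightInvSeq, List.mem_cons]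
    by_cases h1 : invParity cs (cs.wordProd l) t = 0
    · left
      rw [cs.wordProd_cons, invParity_mul, h1, invParity_simple] at h
      have : cs.wordProd l * t * (cs.wordProd l)⁻¹ = cs.simple i := by
        by_contra h2; simp [h2] at h
      rw [← this]; group
    · exact Or.inr (ih h1)

theorem invParity_reflection {t : W} (ht : cs.IsReflection t) : invParity cs t t = 1 := by
  obtain ⟨w, i, rfl⟩ := ht
  have h1 := invParity_mul cs w w⁻¹ (w * cs.simple i * w⁻¹)
  rw [mul_inv_cancel, invParity_one] at h1
  rw [invParity_mul, invParity_mul]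
  simp only [mul_assoc, inv_mul_cancel_left, inv_inv, inv_mul_cancel, mul_one,
    cs.inv_simple, cs.simple_mul_simple_cancel_left, invParity_simple, if_true] at h1 ⊢
  rw [add_left_comm, ← h1, add_zero]

theorem isRightInversion_iff_invParity (w t : W) :
    cs.IsRightInversion w t ↔ invParity cs w t = 1 := by
  have key (w t : W) (h : invParity cs w t = 1) : cs.IsRightInversion w t := by
    obtain ⟨l, hl, rfl⟩ := cs.exists_isReduced w
    exact cs.isRightInversion_of_mem_rightInvSeq hl
      (mem_rightInvSeq_of_invParity cs (by rw [h]; exact one_ne_zero))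
  refine ⟨fun h => ?_, key w t⟩
  by_contra h0
  have h0 : invParity cs w t = 0 := by
    generalize invParity cs w t = a at h0
    revert h0; revert a; decide
  refine (h.1.isRightInversion_mul_left_iff.mp (key (w * t) t ?_)) h
  rw [invParity_mul, invParity_reflection cs h.1, mul_inv_cancel_right, h0, add_zero]

/-- The cocycle property `N(uv) = N(u) Δ u N(v) u⁻¹` of left inversion sets. -/
theorem mem_invSet_mul (u v t : W) :
    t ∈ invSet cs (u * v) ↔ ¬ (t ∈ invSet cs u ↔ u⁻¹ * t * u ∈ invSet cs v) := by
  simp only [invSet, Set.mem_ofPred_eq, ← cs.isRightInversion_inv_iff,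
    isRightInversion_iff_invParity]
  rw [mul_inv_rev, invParity_mul, inv_inv]
  generalize invParity cs u⁻¹ t = a
  generalize invParity cs v⁻¹ _ = b
  revert a b; decide

end InversionParity

section InversionSets

theorem invSet_one : invSet cs 1 = ∅ := by
  ext t; simp [invSet, CoxeterSystem.IsLeftInversion]

theorem mem_invSet_simple (i : B) (t : W) : t ∈ invSet cs (cs.simple i) ↔ t = cs.simple i := by
  simp only [invSet, Set.mem_ofPred_eq, ← cs.isRightInversion_inv_iff,
    isRightInversion_iff_invParity, cs.inv_simple, invParity_simple]
  split_ifs with h <;> simp [h]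

theorem isReflection_of_mem_invSet {w t : W} (h : t ∈ invSet cs w) : cs.IsReflection t := h.1

theorem mem_invSet_mul_simple (w : W) (i : B) (t : W) :
    t ∈ invSet cs (w * cs.simple i) ↔
      ¬ (t ∈ invSet cs w ↔ t = w * cs.simple i * w⁻¹) := by
  rw [mem_invSet_mul, mem_invSet_simple]
  have : w⁻¹ * t * w = cs.simple i ↔ t = w * cs.simple i * w⁻¹ := by
    constructor
    · intro h; rw [← h]; group
    · rintro rfl; group
  rw [this]

theorem conj_simple_mem_invSet (w : W) (i : B) :
    w * cs.simple i * w⁻¹ ∈ invSet cs w ↔ cs.IsRightDescent w i := by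
  simp only [invSet, Set.mem_ofPred_eq, CoxeterSystem.IsLeftInversion, CoxeterSystem.IsRightDescent,
    inv_mul_cancel_right, and_iff_right_iff_imp]
  exact fun _ => (cs.isReflection_simple i).conj w

theorem ncard_invSet [Finite W] (w : W) : (invSet cs w).ncard = cs.length w := by
  induction h : cs.length w generalizing w with
  | zero =>
    rw [cs.length_eq_zero_iff] at h
    simp [h, invSet_one]
  | succ n ih =>
    have hw : w ≠ 1 := by rintro rfl; simp at h
    obtain ⟨i, hi⟩ := cs.exists_rightDescent_of_ne_one hw
    have hmem := (conj_simple_mem_invSet cs w i).mpr hi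
    have hset : invSet cs w = insert (w * cs.simple i * w⁻¹) (invSet cs (w * cs.simple i)) := by
      ext t
      rw [Set.mem_insert_iff, mem_invSet_mul_simple]
      by_cases ht : t = w * cs.simple i * w⁻¹
      · simp [ht, hmem]
      · simp [ht]
    rw [cs.isRightDescent_iff] at hi
    rw [hset, Set.ncard_insert_of_notMem, ih _ (by omega)]
    rw [mem_invSet_mul_simple]
    simp [hmem]

theorem length_mul_eq_iff [Finite W] (u v : W) :
    cs.length (u * v) = cs.length u + cs.length v ↔ invSet cs u ⊆ invSet cs (u * v) := by
  set C : Set W := (fun t => u * t * u⁻¹) '' invSet cs v with hC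
  have hinj : Function.Injective (fun t => u * t * u⁻¹) := fun a b h => by simpa using h
  have hmem (t : W) : u⁻¹ * t * u ∈ invSet cs v ↔ t ∈ C := by
    rw [hC]
    constructor
    · intro h; exact ⟨_, h, by group⟩
    · rintro ⟨t, h, rfl⟩
      convert h using 1; group
  have hcard : C.ncard = cs.length v := by
    rw [hC, Set.ncard_image_of_injective _ hinj, ncard_invSet]
  rw [← ncard_invSet, ← ncard_invSet cs u, ← hcard]
  constructor
  · intro h t ht
    by_contra htn
    have htC : t ∈ C := by
      rw [mem_invSet_mul, hmem] at htn
      tauto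
    have hsub : invSet cs (u * v) ⊆ (invSet cs u \ {t}) ∪ C := by
      intro r hr
      have hrt : r ≠ t := by rintro rfl; exact htn hr
      rw [mem_invSet_mul, hmem] at hr
      simp only [Set.mem_union, Set.mem_sdiff, Set.mem_singleton_iff]
      tauto
    have h1 := Set.ncard_le_ncard hsub
    have h2 := Set.ncard_union_le (invSet cs u \ {t}) C
    have h3 := Set.ncard_sdiff_singleton_add_one ht
    omega
  · intro h
    rw [← Set.ncard_union_eq]
    · congr 1
      ext t
      have := @h t
      rw [mem_invSet_mul, hmem] at *
      simp only [Set.mem_union]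
      tauto
    · rw [Set.disjoint_left]
      intro t h1 h2
      have := h h1
      rw [mem_invSet_mul, hmem] at this
      tauto

theorem length_mul_eq_iff_forall [Finite W] (u v : W) :
    cs.length (u * v) = cs.length u + cs.length v ↔
      ∀ t ∈ invSet cs v, u * t * u⁻¹ ∉ invSet cs u := by
  rw [length_mul_eq_iff]
  constructor
  · intro h t ht hu
    have := h hu
    rw [mem_invSet_mul] at this
    simp only [mul_assoc, inv_mul_cancel_left, inv_mul_cancel, mul_one] at this hu
    tauto
  · intro h t ht
    rw [mem_invSet_mul]
    have := h (u⁻¹ * t * u)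
    simp only [mul_assoc, mul_inv_cancel_left, mul_inv_cancel, mul_one] at this ⊢
    tauto

theorem mem_invSet_mul_of_length [Finite W] {u v : W}
    (h : cs.length (u * v) = cs.length u + cs.length v) (t : W) :
    t ∈ invSet cs (u * v) ↔ t ∈ invSet cs u ∨ u⁻¹ * t * u ∈ invSet cs v := by
  have := Set.subset_def.mp ((length_mul_eq_iff cs u v).mp h) t
  rw [mem_invSet_mul] at *
  tauto

theorem length_eq_of_invSet_subset [Finite W] {u v : W} (h : invSet cs u ⊆ invSet cs v) :
    cs.length v = cs.length u + cs.length (u⁻¹ * v) := by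
  simpa using (length_mul_eq_iff cs u (u⁻¹ * v)).mpr (by simpa using h)

theorem length_le_of_invSet_subset [Finite W] {u v : W} (h : invSet cs u ⊆ invSet cs v) :
    cs.length u ≤ cs.length v := by
  rw [length_eq_of_invSet_subset cs h]; omega

theorem eq_of_invSet_subset_of_length_le [Finite W] {u v : W} (h : invSet cs u ⊆ invSet cs v)
    (hl : cs.length v ≤ cs.length u) : u = v := by
  have := length_eq_of_invSet_subset cs h
  have : cs.length (u⁻¹ * v) = 0 := by omega
  rw [cs.length_eq_zero_iff] at this
  exact inv_mul_eq_one.mp this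

theorem invSet_injective [Finite W] : Function.Injective (invSet cs) := fun _ _ h =>
  eq_of_invSet_subset_of_length_le cs h.subset (length_le_of_invSet_subset cs h.symm.subset)

theorem length_lt_of_invSet_subset [Finite W] {u v : W} (h : invSet cs u ⊆ invSet cs v)
    (hne : u ≠ v) : cs.length u < cs.length v := by
  by_contra hl
  exact hne (eq_of_invSet_subset_of_length_le cs h (not_lt.mp hl))

theorem invSet_mul_simple_subset {w : W} {i : B} (hi : cs.IsRightDescent w i) :
    invSet cs (w * cs.simple i) ⊆ invSet cs w := by
  intro t ht
  rw [mem_invSet_mul_simple] at ht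
  by_cases h : t = w * cs.simple i * w⁻¹
  · rw [h]; exact (conj_simple_mem_invSet cs w i).mpr hi
  · tauto

theorem mem_invSet_mul_simple_of_descent {w : W} {i : B} (hi : cs.IsRightDescent w i) (t : W) :
    t ∈ invSet cs (w * cs.simple i) ↔ t ∈ invSet cs w ∧ t ≠ w * cs.simple i * w⁻¹ := by
  have := Set.subset_def.mp (invSet_mul_simple_subset cs hi) t
  rw [mem_invSet_mul_simple] at *
  tauto

/-- An element strictly below `w` in the weak order lies below `w sᵢ` for a right descent `i`. -/
theorem exists_descent_of_invSet_subset [Finite W] {u w : W} (h : invSet cs u ⊆ invSet cs w)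
    (hne : u ≠ w) : ∃ i, cs.IsRightDescent w i ∧ invSet cs u ⊆ invSet cs (w * cs.simple i) ∧
      w * cs.simple i * w⁻¹ ∉ invSet cs u := by
  obtain ⟨i, hi⟩ := cs.exists_rightDescent_of_ne_one
    (w := u⁻¹ * w) (by rwa [ne_eq, inv_mul_eq_one])
  have hl := length_eq_of_invSet_subset cs h
  have h1 := cs.length_mul_le u (u⁻¹ * w * cs.simple i)
  rw [← mul_assoc, mul_inv_cancel_left] at h1
  rw [cs.isRightDescent_iff] at hi
  have hw : cs.IsRightDescent w i := by
    unfold CoxeterSystem.IsRightDescent; omega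
  have hw' := cs.isRightDescent_iff.mp hw
  have hsub : invSet cs u ⊆ invSet cs (w * cs.simple i) := by
    have := (length_mul_eq_iff cs u (u⁻¹ * w * cs.simple i)).mp
    rw [← mul_assoc, mul_inv_cancel_left] at this
    exact this (by omega)
  refine ⟨i, hw, hsub, fun h2 => ?_⟩
  exact ((mem_invSet_mul_simple_of_descent cs hw _).mp (hsub h2)).2 rfl

end InversionSets

section ParabolicSubgroups

theorem simple_mem_parab {K : Set B} {k : B} (hk : k ∈ K) : cs.simple k ∈ parab cs K :=
  Subgroup.subset_closure ⟨k, hk, rfl⟩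

theorem parab_mono {K L : Set B} (h : K ⊆ L) : parab cs K ≤ parab cs L :=
  Subgroup.closure_mono (Set.image_mono h)

theorem invSet_subset_parab {K : Set B} {w : W} (hw : w ∈ parab cs K) :
    invSet cs w ⊆ parab cs K := by
  induction hw using Subgroup.closure_induction with
  | mem x hx =>
    obtain ⟨k, hk, rfl⟩ := hx
    intro t ht
    rw [mem_invSet_simple] at ht
    rw [ht]
    exact simple_mem_parab cs hk
  | one => simp [invSet_one]
  | mul x y hx hy ihx ihy =>
    intro t ht
    rw [mem_invSet_mul] at ht
    by_cases h : t ∈ invSet cs x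
    · exact ihx h
    · have h1 : x⁻¹ * t * x ∈ parab cs K := ihy (by tauto)
      have := mul_mem (mul_mem hx h1) (inv_mem hx)
      simpa [mul_assoc, parab] using this
  | inv x hx ih =>
    intro t ht
    have h1 := mem_invSet_mul cs x x⁻¹ (x * t * x⁻¹)
    rw [mul_inv_cancel, invSet_one] at h1
    have h2 : x⁻¹ * (x * t * x⁻¹) * x = t := by group
    rw [h2] at h1
    have h3 : x * t * x⁻¹ ∈ parab cs K := ih (by simp only [Set.mem_empty_iff_false] at h1; tauto)
    have := mul_mem (mul_mem (inv_mem hx) h3) hx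
    rwa [h2] at this

theorem mem_parab_of_invSet_subset {K : Set B} {w : W}
    (hw : invSet cs w ⊆ parab cs K) : w ∈ parab cs K := by
  induction h : cs.length w generalizing w with
  | zero =>
    rw [cs.length_eq_zero_iff] at h
    rw [h]; exact one_mem _
  | succ n ih =>
    obtain ⟨i, hi⟩ := cs.exists_rightDescent_of_ne_one (w := w) (by rintro rfl; simp at h)
    have h1 := ih ((invSet_mul_simple_subset cs hi).trans hw)
      (by rw [cs.isRightDescent_iff] at hi; omega)
    have h2 := hw ((conj_simple_mem_invSet cs w i).mpr hi)
    have := mul_mem h2 h1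
    simpa using this

/-- Elements reached from `1` by length-increasing right multiplications with generators in `K`. -/
inductive IsReducedIn (K : Set B) : W → Prop
  | one : IsReducedIn K 1
  | step (y : W) (k : B) : k ∈ K → IsReducedIn K y → ¬ cs.IsRightDescent y k →
      IsReducedIn K (y * cs.simple k)

theorem IsReducedIn.reflection_mul {K : Set B} {y t : W} (hy : IsReducedIn cs K y)
    (ht : t ∈ invSet cs y) : IsReducedIn cs K (t * y) := by
  induction h : cs.length y using Nat.strong_induction_on generalizing y t with
  | _ n ih =>
    cases hy with
    | one => simp [invSet_one] at ht
    | step y k hk hy hd =>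
      rw [cs.not_isRightDescent_iff] at hd
      by_cases htk : t = y * cs.simple k * y⁻¹
      · rw [htk]; simpa
      have hty : t ∈ invSet cs y := by
        rw [mem_invSet_mul_simple] at ht
        tauto
      have hg := ih _ (by omega) hy hty rfl
      rw [← mul_assoc]
      by_cases hd' : cs.IsRightDescent (t * y) k
      · have := ih _ (by have := hty.2; omega) hg ((conj_simple_mem_invSet cs _ k).mpr hd') rfl
        simpa [mul_assoc] using this
      · exact .step _ _ hk hg hd'

theorem isReducedIn_of_mem_parab {K : Set B} {y : W} (hy : y ∈ parab cs K) :
    IsReducedIn cs K y := by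
  have step {y : W} {k : B} (hk : k ∈ K) (h : IsReducedIn cs K y) :
      IsReducedIn cs K (y * cs.simple k) := by
    by_cases hd : cs.IsRightDescent y k
    · simpa using h.reflection_mul cs ((conj_simple_mem_invSet cs y k).mpr hd)
    · exact .step _ _ hk h hd
  induction hy using Subgroup.closure_induction_right with
  | one => exact .one
  | mul_right x y hx hy ih =>
    obtain ⟨k, hk, rfl⟩ := hy
    exact step hk ih
  | mul_inv_cancel x y hx hy ih =>
    obtain ⟨k, hk, rfl⟩ := hy
    rw [cs.inv_simple]
    exact step hk ih

theorem exists_descent_of_mem_parab {K : Set B} {y : W} (hy : y ∈ parab cs K) (h1 : y ≠ 1) :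
    ∃ k ∈ K, cs.IsRightDescent y k := by
  cases isReducedIn_of_mem_parab cs hy with
  | one => exact absurd rfl h1
  | step y k hk hy hd =>
    refine ⟨k, hk, ?_⟩
    rw [cs.not_isRightDescent_iff] at hd
    unfold CoxeterSystem.IsRightDescent
    simp [hd]

theorem exists_factorization [Finite W] (K : Set B) (w : W) :
    ∃ x, ∃ y ∈ parab cs K, w = x * y ∧
      ∀ z ∈ parab cs K, cs.length (x * z) = cs.length x + cs.length z := by
  obtain ⟨x, ⟨y, hy, rfl⟩, hmin⟩ := (measure cs.length).wf.has_min
    {x | ∃ y ∈ parab cs K, w = x * y} ⟨w, 1, one_mem _, by simp⟩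
  refine ⟨x, y, hy, rfl, fun z hz => ?_⟩
  rw [length_mul_eq_iff_forall]
  intro t ht htx
  have htK := invSet_subset_parab cs hz ht
  refine hmin (x * t) ⟨t⁻¹ * y, mul_mem (inv_mem htK) hy, by group⟩ ?_
  have := htx.2
  rwa [inv_mul_cancel_right] at this

theorem IsMinRep.length_mul [Finite W] {K : Set B} {x y : W} (hx : IsMinRep cs K x)
    (hy : y ∈ parab cs K) : cs.length (x * y) = cs.length x + cs.length y := by
  obtain ⟨x₀, y₀, hy₀, rfl, h⟩ := exists_factorization cs K x
  by_cases h1 : y₀ = 1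
  · subst h1; simpa using h y hy
  · obtain ⟨k, hk, hd⟩ := exists_descent_of_mem_parab cs hy₀ h1
    refine absurd ?_ (hx k hk)
    unfold CoxeterSystem.IsRightDescent at hd ⊢
    rw [mul_assoc, h _ hy₀, h _ (mul_mem hy₀ (simple_mem_parab cs hk))]
    omega

theorem isMinRep_of_length_mul {K : Set B} {x : W}
    (h : ∀ z ∈ parab cs K, cs.length (x * z) = cs.length x + cs.length z) : IsMinRep cs K x := by
  intro k hk
  rw [cs.not_isRightDescent_iff, h _ (simple_mem_parab cs hk), cs.length_simple]

theorem IsMinRep.conj_notMem_invSet [Finite W] {K : Set B} {x t : W} (hx : IsMinRep cs K x)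
    (ht : x⁻¹ * t * x ∈ parab cs K) : t ∉ invSet cs x := by
  intro h
  have h1 := hx.length_mul cs ht
  rw [mul_assoc, mul_inv_cancel_left] at h1
  have := h.2
  omega

theorem exists_longest [Finite W] (K : Set B) :
    ∃ w₀ ∈ parab cs K, ∀ y ∈ parab cs K, invSet cs y ⊆ invSet cs w₀ := by
  obtain ⟨w₀, h₀, hmax⟩ := (Set.toFinite (parab cs K : Set W)).exists_maximalFor cs.length _
    ⟨1, one_mem _⟩
  refine ⟨w₀, h₀, fun y hy t ht => ⟨ht.1, ?_⟩⟩
  have hne := ht.1.length_mul_right_ne w₀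
  have htK : t * w₀ ∈ parab cs K := mul_mem (invSet_subset_parab cs hy ht) h₀
  by_contra hlt
  exact hlt (lt_of_le_of_ne (hmax htK (by omega)) hne)

/-- The longest element of the standard parabolic subgroup `W_K`. -/
noncomputable def longest [Finite W] (K : Set B) : W := (exists_longest cs K).choose

variable [Finite W]

theorem longest_mem (K : Set B) : longest cs K ∈ parab cs K := (exists_longest cs K).choose_spec.1

theorem invSet_subset_longest {K : Set B} {y : W} (hy : y ∈ parab cs K) :
    invSet cs y ⊆ invSet cs (longest cs K) := (exists_longest cs K).choose_spec.2 y hy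

theorem longest_inv (K : Set B) : (longest cs K)⁻¹ = longest cs K :=
  eq_of_invSet_subset_of_length_le cs (invSet_subset_longest cs (inv_mem (longest_mem cs K)))
    (cs.length_inv _).ge

theorem longest_mul_self (K : Set B) : longest cs K * longest cs K = 1 := by
  nth_rw 1 [← longest_inv]; simp

theorem length_longest_mul {K : Set B} {y : W} (hy : y ∈ parab cs K) :
    cs.length (longest cs K) = cs.length (longest cs K * y) + cs.length y := by
  have := length_eq_of_invSet_subset cs
    (invSet_subset_longest cs (mul_mem (longest_mem cs K) hy))
  simpa using this

theorem length_mul_longest {K : Set B} {y : W} (hy : y ∈ parab cs K) :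
    cs.length (longest cs K) = cs.length (y * longest cs K) + cs.length y := by
  have := length_longest_mul cs (inv_mem hy)
  rw [cs.length_inv, ← cs.length_inv (_ * _), mul_inv_rev, inv_inv, longest_inv] at this
  exact this

theorem eq_longest_of_descents {K : Set B} {y : W} (hy : y ∈ parab cs K)
    (h : ∀ k ∈ K, cs.IsRightDescent y k) : y = longest cs K := by
  have h1 : longest cs K * y = 1 := by
    by_contra h1
    obtain ⟨k, hk, hd⟩ := exists_descent_of_mem_parab cs (mul_mem (longest_mem cs K) hy) h1
    have e1 := length_longest_mul cs hy
    have e2 := length_longest_mul cs (mul_mem hy (simple_mem_parab cs hk))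
    have e3 := h k hk
    unfold CoxeterSystem.IsRightDescent at hd e3
    rw [mul_assoc] at hd
    omega
  rw [← inv_eq_of_mul_eq_one_right h1, longest_inv]

theorem IsMinRep.isRightDescent_mul_longest {K : Set B} {x : W} (hx : IsMinRep cs K x)
    {k : B} (hk : k ∈ K) : cs.IsRightDescent (x * longest cs K) k := by
  have hkK := simple_mem_parab cs hk
  unfold CoxeterSystem.IsRightDescent
  rw [mul_assoc, hx.length_mul cs (longest_mem cs K),
    hx.length_mul cs (mul_mem (longest_mem cs K) hkK), length_longest_mul cs hkK, cs.length_simple]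
  omega

/-- Right multiplication by the longest element of `W_K` exchanges elements having all
of `K` as right descents with minimal coset representatives. -/
theorem isMinRep_mul_longest_iff {K : Set B} {v : W} :
    IsMinRep cs K (v * longest cs K) ↔ ∀ k ∈ K, cs.IsRightDescent v k := by
  constructor
  · intro h k hk
    have := h.isRightDescent_mul_longest cs hk
    rwa [mul_assoc, longest_mul_self, mul_one] at this
  · intro h
    obtain ⟨x, y, hy, rfl, hx⟩ := exists_factorization cs K v
    have : y = longest cs K := by
      refine eq_longest_of_descents cs hy fun k hk => ?_
      have := h k hk
      unfold CoxeterSystem.IsRightDescent at this ⊢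
      rw [mul_assoc, hx _ hy, hx _ (mul_mem hy (simple_mem_parab cs hk))] at this
      omega
    rw [this, mul_assoc, longest_mul_self, mul_one]
    exact isMinRep_of_length_mul cs hx

end ParabolicSubgroups

section Support

theorem mem_supp_iff (w : W) (i : B) : i ∈ supp cs w ↔
    ∃ u c, w = u * cs.simple i * c ∧ cs.length w = cs.length u + 1 + cs.length c := by
  constructor
  · rintro ⟨l, hl, rfl, hi⟩
    obtain ⟨l₁, l₂, rfl⟩ := List.append_of_mem hi
    refine ⟨cs.wordProd l₁, cs.wordProd l₂, ?_, ?_⟩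
    · rw [cs.wordProd_append, cs.wordProd_cons, mul_assoc]
    · have h1 := cs.length_wordProd_le l₁
      have h2 := cs.length_wordProd_le l₂
      have h3 := cs.length_mul_le (cs.wordProd l₁) (cs.simple i * cs.wordProd l₂)
      have h4 := cs.length_mul_le (cs.simple i) (cs.wordProd l₂)
      rw [cs.length_simple] at h4
      have h5 : cs.length _ = _ := hl
      rw [List.length_append, List.length_cons] at h5
      rw [← cs.wordProd_cons, ← cs.wordProd_append] at h3
      rw [← cs.wordProd_cons] at h4
      omega
  · rintro ⟨u, c, rfl, h⟩
    obtain ⟨l₁, h₁, rfl⟩ := cs.exists_isReduced u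
    obtain ⟨l₂, h₂, rfl⟩ := cs.exists_isReduced c
    have e : cs.wordProd (l₁ ++ i :: l₂) = cs.wordProd l₁ * cs.simple i * cs.wordProd l₂ := by
      rw [cs.wordProd_append, cs.wordProd_cons, mul_assoc]
    refine ⟨l₁ ++ i :: l₂, ?_, e, by simp⟩
    rw [h₁.eq, h₂.eq] at h
    unfold CoxeterSystem.IsReduced
    rw [e, h, List.length_append, List.length_cons]
    omega

/-- A set of indices is saturated if it only depends on the corresponding simple reflections. -/
def IsSaturated (K : Set B) : Prop := ∀ i j, cs.simple i = cs.simple j → i ∈ K → j ∈ K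

theorem isSaturated_supp (w : W) : IsSaturated cs (supp cs w) := by
  intro i j h hi
  rw [mem_supp_iff] at *
  rwa [← h]

theorem isSaturated_union {K L : Set B} (hK : IsSaturated cs K) (hL : IsSaturated cs L) :
    IsSaturated cs (K ∪ L) := fun i j h hi => hi.imp (hK i j h) (hL i j h)

theorem isSaturated_descents (w : W) : IsSaturated cs {i | cs.IsRightDescent w i} := by
  intro i j h hi
  simp only [Set.mem_ofPred_eq, CoxeterSystem.IsRightDescent] at *
  rwa [← h]

theorem mem_of_simple_mem_parab {K : Set B} (hK : IsSaturated cs K) {i : B}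
    (h : cs.simple i ∈ parab cs K) : i ∈ K := by
  have h1 : cs.simple i ≠ 1 := by
    rw [ne_eq, ← cs.length_eq_zero_iff, cs.length_simple]; exact one_ne_zero
  obtain ⟨k, hk, hd⟩ := exists_descent_of_mem_parab cs h h1
  unfold CoxeterSystem.IsRightDescent at hd
  rw [cs.length_simple, Nat.lt_one_iff, cs.length_eq_zero_iff] at hd
  refine hK k i ?_ hk
  rw [← cs.inv_simple i]
  exact (inv_eq_of_mul_eq_one_right hd).symm

theorem mem_parab_supp (w : W) : w ∈ parab cs (supp cs w) := by
  obtain ⟨l, hl, rfl⟩ := cs.exists_isReduced w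
  have h (i : B) (hi : i ∈ l) : i ∈ supp cs (cs.wordProd l) := ⟨l, hl, rfl, hi⟩
  refine Subgroup.list_prod_mem _ fun x hx => ?_
  obtain ⟨i, hi, rfl⟩ := List.mem_map.mp hx
  exact simple_mem_parab cs (h i hi)

variable [Finite W]

theorem supp_subset_of_mem_parab {K : Set B} (hK : IsSaturated cs K) {w : W}
    (hw : w ∈ parab cs K) : supp cs w ⊆ K := by
  intro i hi
  obtain ⟨u, c, rfl, h⟩ := (mem_supp_iff cs w i).mp hi
  have h1 := cs.length_mul_le (u * cs.simple i) c
  have h2 := cs.length_mul_le u (cs.simple i)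
  rw [cs.length_simple] at h2
  have e1 := (length_mul_eq_iff cs (u * cs.simple i) c).mp (by omega)
  have e2 := (length_mul_eq_iff cs u (cs.simple i)).mp (by rw [cs.length_simple]; omega)
  have hus := mem_parab_of_invSet_subset cs (e1.trans (invSet_subset_parab cs hw))
  have hu := mem_parab_of_invSet_subset cs (e2.trans (invSet_subset_parab cs hus))
  exact mem_of_simple_mem_parab cs hK ((Subgroup.mul_mem_cancel_left _ hu).mp hus)

theorem mem_parab_iff {K : Set B} (hK : IsSaturated cs K) {w : W} :
    w ∈ parab cs K ↔ supp cs w ⊆ K :=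
  ⟨supp_subset_of_mem_parab cs hK, fun h => parab_mono cs h (mem_parab_supp cs w)⟩

theorem supp_mul {u v : W} (h : cs.length (u * v) = cs.length u + cs.length v) :
    supp cs (u * v) = supp cs u ∪ supp cs v := by
  refine Set.Subset.antisymm ?_ (Set.union_subset ?_ ?_)
  · refine supp_subset_of_mem_parab cs
      (isSaturated_union cs (isSaturated_supp cs u) (isSaturated_supp cs v)) (mul_mem ?_ ?_)
    · exact parab_mono cs Set.subset_union_left (mem_parab_supp cs u)
    · exact parab_mono cs Set.subset_union_right (mem_parab_supp cs v)
  · intro i hi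
    obtain ⟨a, b, rfl, hl⟩ := (mem_supp_iff cs u i).mp hi
    refine (mem_supp_iff cs _ i).mpr ⟨a, b * v, by group, ?_⟩
    have h1 := cs.length_mul_le b v
    have h2 := cs.length_mul_le (a * cs.simple i) (b * v)
    have h3 := cs.length_mul_le a (cs.simple i)
    rw [cs.length_simple] at h3
    rw [← mul_assoc] at h2
    omega
  · intro i hi
    obtain ⟨a, b, rfl, hl⟩ := (mem_supp_iff cs v i).mp hi
    refine (mem_supp_iff cs _ i).mpr ⟨u * a, b, by group, ?_⟩
    have h1 := cs.length_mul_le u a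
    have h2 := cs.length_mul_le (u * a * cs.simple i) b
    have h3 := cs.length_mul_le (u * a) (cs.simple i)
    rw [cs.length_simple] at h3
    rw [← mul_assoc, ← mul_assoc] at *
    omega

theorem supp_longest {K : Set B} (hK : IsSaturated cs K) : supp cs (longest cs K) = K := by
  refine (supp_subset_of_mem_parab cs hK (longest_mem cs K)).antisymm fun k hk => ?_
  refine (mem_supp_iff cs _ k).mpr ⟨longest cs K * cs.simple k, 1, by simp, ?_⟩
  have := length_longest_mul cs (simple_mem_parab cs hk)
  rw [cs.length_simple] at this
  simpa using this

end Support

section KilmoyerIntersection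

variable [Finite W]

/-- If `a` is minimal in `a W_R` then `a W_R a⁻¹ ∩ W_I` is generated by the conjugates
`a s a⁻¹ ∈ W_I` with `s ∈ R`. -/
theorem IsMinRep.mem_parab_of_conj_mem {I R : Set B} {a τ : W} (ha : IsMinRep cs R a)
    (hτ : τ ∈ parab cs R) (h : a * τ * a⁻¹ ∈ parab cs I) :
    τ ∈ parab cs {r | r ∈ R ∧ a * cs.simple r * a⁻¹ ∈ parab cs I} := by
  obtain ⟨x, y, hy, hxy, hx⟩ := exists_factorization cs I a⁻¹
  have hxm := isMinRep_of_length_mul cs hx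
  have ea : a = y⁻¹ * x⁻¹ := by rw [← mul_inv_rev, ← hxy, inv_inv]
  have conj_iff (σ : W) : a * σ * a⁻¹ ∈ parab cs I ↔ x⁻¹ * σ * x ∈ parab cs I := by
    have e : a * σ * a⁻¹ = y⁻¹ * (x⁻¹ * σ * x) * y := by rw [ea]; group
    rw [e, Subgroup.mul_mem_cancel_right _ hy, Subgroup.mul_mem_cancel_left _ (inv_mem hy)]
  have hb : IsMinRep cs R x⁻¹ := by
    intro r hr hd
    refine ha r hr ?_
    unfold CoxeterSystem.IsRightDescent at hd ⊢
    have h1 : cs.length a = cs.length x + cs.length y := by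
      rw [← cs.length_inv, hxy, hx y hy]
    have h2 := cs.length_mul_le y⁻¹ (x⁻¹ * cs.simple r)
    rw [← mul_assoc, ← ea, cs.length_inv] at h2
    rw [cs.length_inv] at hd
    omega
  simp only [conj_iff] at h ⊢
  clear conj_iff ea hxy ha
  induction hn : cs.length τ using Nat.strong_induction_on generalizing τ with
  | _ n ih =>
  subst hn
  by_cases h1 : τ = 1
  · rw [h1]; exact one_mem _
  obtain ⟨r, hr, hd⟩ := exists_descent_of_mem_parab cs hτ h1
  have hrR := simple_mem_parab cs hr
  have hτ' := mul_mem hτ hrR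
  have key : ∃ i ∈ I, cs.IsRightDescent (cs.simple r * x) i := by
    by_contra hno
    push Not at hno
    have hm : IsMinRep cs I (cs.simple r * x) := hno
    have l1 := hm.length_mul cs (inv_mem h)
    have l2 := hx _ (inv_mem h)
    have l3 := hb.length_mul cs hτ
    have l4 := hb.length_mul cs hτ'
    have l5 := hb.length_mul cs hrR
    have e1 : cs.length (cs.simple r * x * (x⁻¹ * τ * x)⁻¹)
        = cs.length (x⁻¹ * (τ * cs.simple r)) := by
      rw [← cs.length_inv]; congr 1; simp [mul_assoc]
    have e2 : cs.length (x * (x⁻¹ * τ * x)⁻¹) = cs.length (x⁻¹ * τ) := by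
      rw [← cs.length_inv]; congr 1; simp [mul_assoc]
    have e3 : cs.length (cs.simple r * x) = cs.length (x⁻¹ * cs.simple r) := by
      rw [← cs.length_inv]; congr 1; simp
    rw [cs.length_simple] at l5
    rw [cs.length_inv] at l1 l2 l3 l4 l5
    unfold CoxeterSystem.IsRightDescent at hd
    omega
  obtain ⟨i, hi, hdi⟩ := key
  have hs : cs.simple i = x⁻¹ * cs.simple r * x := by
    have h2 : cs.simple i ∈ invSet cs (x⁻¹ * cs.simple r) := by
      refine ⟨cs.isReflection_simple i, ?_⟩
      unfold CoxeterSystem.IsRightDescent at hdi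
      rw [← cs.length_inv, ← cs.length_inv (x⁻¹ * _)]
      simpa [mul_assoc] using hdi
    have h3 : cs.simple i ∉ invSet cs x⁻¹ := by
      rintro ⟨-, h3⟩
      refine hxm i hi ?_
      unfold CoxeterSystem.IsRightDescent
      rw [← cs.length_inv, ← cs.length_inv x]
      simpa using h3
    rw [mem_invSet_mul_simple, inv_inv] at h2
    tauto
  have hrI : x⁻¹ * cs.simple r * x ∈ parab cs I := hs ▸ simple_mem_parab cs hi
  have := ih _ hd hτ' (by
    have e : x⁻¹ * (τ * cs.simple r) * x = (x⁻¹ * τ * x) * (x⁻¹ * cs.simple r * x) := by group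
    rw [e]; exact mul_mem h hrI) rfl
  have h4 := mul_mem this (simple_mem_parab cs
    (K := {r | r ∈ R ∧ x⁻¹ * cs.simple r * x ∈ parab cs I}) ⟨hr, hrI⟩)
  simpa [mul_assoc] using h4

end KilmoyerIntersection

section NormalForm

theorem mem_descConj_iff (v t : W) :
    t ∈ descConj cs v ↔ v⁻¹ * t * v ∈ parab cs {i | cs.IsRightDescent v i} := by
  have e : descConj cs v =
      (parab cs {i | cs.IsRightDescent v i}).map (MulAut.conj v).toMonoidHom := by
    unfold descConj parab
    rw [MonoidHom.map_closure]
    congr 1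
    ext x
    simp only [Set.mem_image, Set.mem_ofPred_eq, exists_exists_and_eq_and]
    simp [eq_comm]
  rw [e, Subgroup.mem_map]
  constructor
  · rintro ⟨y, hy, rfl⟩
    simpa [mul_assoc] using hy
  · intro h
    exact ⟨_, h, by simp [mul_assoc]⟩

/-- All the reflections attached to the right descents of `u` lie in `G`. -/
def IsNormal (G : Subgroup W) (u : W) : Prop :=
  ∀ i, cs.IsRightDescent u i → u * cs.simple i * u⁻¹ ∈ G

/-- `u` is obtained from `w` by going down in the weak order until every descent
reflection lies in `G`, without ever removing an inversion in `G`. -/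
def IsNormalForm (G : Subgroup W) (w u : W) : Prop :=
  IsNormal cs G u ∧ invSet cs u ⊆ invSet cs w ∧ ∀ t ∈ G, t ∈ invSet cs w → t ∈ invSet cs u

theorem mem_invSet_mul_simple_of_mem {G : Subgroup W} {w : W} {i : B}
    (hi : cs.IsRightDescent w i) (hG : w * cs.simple i * w⁻¹ ∉ G) (t : W) (ht : t ∈ G)
    (htw : t ∈ invSet cs w) : t ∈ invSet cs (w * cs.simple i) :=
  (mem_invSet_mul_simple_of_descent cs hi t).mpr ⟨htw, fun h => hG (h ▸ ht)⟩

variable {cs}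

theorem IsNormalForm.of_subset {G : Subgroup W} {w z p : W} (h : IsNormalForm cs G z p)
    (hzw : invSet cs z ⊆ invSet cs w) (hG : ∀ t ∈ G, t ∈ invSet cs w → t ∈ invSet cs z) :
    IsNormalForm cs G w p :=
  ⟨h.1, h.2.1.trans hzw, fun t ht htw => h.2.2 t ht (hG t ht htw)⟩

theorem IsNormal.isNormalForm {G : Subgroup W} {w : W} (h : IsNormal cs G w) :
    IsNormalForm cs G w w := ⟨h, subset_rfl, fun _ _ => id⟩

theorem mem_parab_singleton {i : B} {τ : W} (h : τ ∈ parab cs {i}) (h1 : τ ≠ 1) :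
    τ = cs.simple i := by
  by_contra hne
  obtain ⟨k, rfl, hk⟩ := exists_descent_of_mem_parab cs h h1
  have h2 : τ * cs.simple k ≠ 1 := fun h2 => hne (by
    rw [eq_inv_of_mul_eq_one_left h2, cs.inv_simple])
  obtain ⟨l, rfl, hl⟩ := exists_descent_of_mem_parab cs
    (mul_mem h (simple_mem_parab cs (Set.mem_singleton k))) h2
  unfold CoxeterSystem.IsRightDescent at hk hl
  rw [mul_assoc, cs.simple_mul_simple_self, mul_one] at hl
  omega

variable (cs)

theorem exists_isNormalForm (G : Subgroup W) (w : W) : ∃ u, IsNormalForm cs G w u := by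
  induction hn : cs.length w using Nat.strong_induction_on generalizing w with
  | _ n ih =>
  subst hn
  by_cases h : IsNormal cs G w
  · exact ⟨w, h.isNormalForm⟩
  · unfold IsNormal at h
    push Not at h
    obtain ⟨i, hi, hG⟩ := h
    obtain ⟨u, hu⟩ := ih _ hi _ rfl
    exact ⟨u, hu.of_subset (invSet_mul_simple_subset cs hi) (mem_invSet_mul_simple_of_mem cs hi hG)⟩

variable [Finite W]

theorem mem_parab_of_conj_mem_descConj {v w τ : W} {R : Set B} (hwv : invSet cs w ⊆ invSet cs v)
    (hR : ∀ r ∈ R, cs.IsRightDescent w r) (hτ : τ ∈ parab cs R)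
    (h : w * τ * w⁻¹ ∈ descConj cs v) :
    τ ∈ parab cs {r | r ∈ R ∧ w * cs.simple r * w⁻¹ ∈ descConj cs v} := by
  have e (σ : W) : v⁻¹ * (w * σ * w⁻¹) * v = (v⁻¹ * w) * σ * (v⁻¹ * w)⁻¹ := by group
  simp only [mem_descConj_iff cs v, e] at h ⊢
  refine IsMinRep.mem_parab_of_conj_mem cs ?_ hτ h
  intro r hr hd
  have h1 := hR r hr
  have h2 := length_eq_of_invSet_subset cs hwv
  unfold CoxeterSystem.IsRightDescent at hd h1
  have h3 := cs.length_mul_le (w * cs.simple r) (v⁻¹ * w * cs.simple r)⁻¹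
  have e3 : w * cs.simple r * (v⁻¹ * w * cs.simple r)⁻¹ = v := by group
  have e4 : v⁻¹ * w = (w⁻¹ * v)⁻¹ := by group
  rw [e3, cs.length_inv] at h3
  nth_rw 2 [e4] at hd
  rw [cs.length_inv] at hd
  omega

theorem invSet_mul_longest_subset {w : W} {R : Set B} (hR : ∀ r ∈ R, cs.IsRightDescent w r) :
    invSet cs (w * longest cs R) ⊆ invSet cs w := by
  have h := ((isMinRep_mul_longest_iff cs).mpr hR).length_mul cs (longest_mem cs R)
  have h' := (length_mul_eq_iff cs _ _).mp h
  rwa [mul_assoc, longest_mul_self, mul_one] at h'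

theorem conj_mem_parab_of_mem_invSet {w t : W} {R : Set B} (ht : t ∈ invSet cs w)
    (ht' : t ∉ invSet cs (w * longest cs R)) : w⁻¹ * t * w ∈ parab cs R := by
  have e : w = (w * longest cs R) * longest cs R := by
    rw [mul_assoc, longest_mul_self, mul_one]
  rw [e, mem_invSet_mul] at ht
  have h2 : (w * longest cs R)⁻¹ * t * (w * longest cs R) ∈ invSet cs (longest cs R) := by tauto
  have h3 := invSet_subset_parab cs (longest_mem cs R) h2
  have h4 := mul_mem (mul_mem (longest_mem cs R) h3) (inv_mem (longest_mem cs R))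
  have e' : longest cs R * ((w * longest cs R)⁻¹ * t * (w * longest cs R)) * (longest cs R)⁻¹
    = w⁻¹ * t * w := by group
  rwa [e'] at h4

theorem invSet_mul_longest_subset_mul_simple {w : W} {R : Set B}
    (hR : ∀ r ∈ R, cs.IsRightDescent w r) {r : B} (hr : r ∈ R) :
    invSet cs (w * longest cs R) ⊆ invSet cs (w * cs.simple r) := by
  have h := ((isMinRep_mul_longest_iff cs).mpr hR).length_mul cs
    (mul_mem (longest_mem cs R) (simple_mem_parab cs hr))
  have h' := (length_mul_eq_iff cs _ _).mp h
  rwa [← mul_assoc, mul_assoc w, longest_mul_self, mul_one] at h'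

theorem conj_simple_notMem_invSet_mul_longest {w : W} {R : Set B}
    (hR : ∀ r ∈ R, cs.IsRightDescent w r) {r : B} (hr : r ∈ R) :
    w * cs.simple r * w⁻¹ ∉ invSet cs (w * longest cs R) := by
  refine ((isMinRep_mul_longest_iff cs).mpr hR).conj_notMem_invSet cs ?_
  have e : (w * longest cs R)⁻¹ * (w * cs.simple r * w⁻¹) * (w * longest cs R)
    = (longest cs R)⁻¹ * cs.simple r * longest cs R := by group
  rw [e]
  exact mul_mem (mul_mem (inv_mem (longest_mem cs R)) (simple_mem_parab cs hr)) (longest_mem cs R)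

variable {cs}

theorem IsNormalForm.exists_descent {G : Subgroup W} {w u : W} (h : IsNormalForm cs G w u)
    (hne : u ≠ w) : ∃ i, cs.IsRightDescent w i ∧ w * cs.simple i * w⁻¹ ∉ G ∧
      IsNormalForm cs G (w * cs.simple i) u := by
  obtain ⟨i, hi, hs, hn⟩ := exists_descent_of_invSet_subset cs h.2.1 hne
  refine ⟨i, hi, fun hG => hn (h.2.2 _ hG ((conj_simple_mem_invSet cs w i).mpr hi)), h.1, hs, ?_⟩
  exact fun t ht htw => h.2.2 t ht (invSet_mul_simple_subset cs hi htw)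

theorem IsNormalForm.eq_self {G : Subgroup W} {w u : W} (h : IsNormalForm cs G w u)
    (hw : IsNormal cs G w) : u = w := by
  by_contra hne
  obtain ⟨i, hi, hG, -⟩ := h.exists_descent hne
  exact hG (hw i hi)

theorem IsNormalForm.unique {v w u u' : W} (hwv : invSet cs w ⊆ invSet cs v)
    (h : IsNormalForm cs (descConj cs v) w u) (h' : IsNormalForm cs (descConj cs v) w u') :
    u = u' := by
  induction hn : cs.length w using Nat.strong_induction_on generalizing w u u' with
  | _ n ih =>
  subst hn
  by_cases hw : IsNormal cs (descConj cs v) w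
  · rw [h.eq_self hw, h'.eq_self hw]
  obtain ⟨i, hi, hG, hu⟩ := h.exists_descent (fun e => hw (e ▸ h.1))
  obtain ⟨j, hj, hG', hu'⟩ := h'.exists_descent (fun e => hw (e ▸ h'.1))
  have hR : ∀ r ∈ ({i, j} : Set B), cs.IsRightDescent w r := by
    rintro r (rfl | rfl) <;> assumption
  obtain ⟨p, hp⟩ := exists_isNormalForm cs (descConj cs v) (w * longest cs {i, j})
  have hsame : ∀ t ∈ descConj cs v, t ∈ invSet cs w →
      t ∈ invSet cs (w * longest cs {i, j}) := by
    intro t ht htw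
    by_contra hz
    have h1 := conj_mem_parab_of_mem_invSet cs htw hz
    have e : w * (w⁻¹ * t * w) * w⁻¹ = t := by group
    have h2 := mem_parab_of_conj_mem_descConj cs hwv hR h1 (by rwa [e])
    have h3 : {r | r ∈ ({i, j} : Set B) ∧ w * cs.simple r * w⁻¹ ∈ descConj cs v} = ∅ := by
      ext r
      simp only [Set.mem_ofPred_eq, Set.mem_empty_iff_false, iff_false]
      rintro ⟨rfl | rfl, h4⟩
      · exact hG h4
      · exact hG' h4
    rw [h3, parab, Set.image_empty, Subgroup.closure_empty, Subgroup.mem_bot] at h2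
    rw [h2] at e
    have h5 := isReflection_of_mem_invSet cs htw
    rw [← e] at h5
    have := h5.odd_length
    simp at this
  have key (k : B) (hk : k ∈ ({i, j} : Set B)) (q : W)
      (hq : IsNormalForm cs (descConj cs v) (w * cs.simple k) q) : q = p := by
    have hs := invSet_mul_simple_subset cs (hR k hk)
    refine ih _ (hR k hk) (hs.trans hwv) hq (hp.of_subset
      (invSet_mul_longest_subset_mul_simple cs hR hk) fun t ht htw => hsame t ht (hs htw)) rfl
  rw [key i (by simp) u hu, key j (by simp) u' hu']

theorem IsNormalForm.descent {v w u u₁ : W} {i : B} (hwv : invSet cs w ⊆ invSet cs v)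
    (h : IsNormalForm cs (descConj cs v) w u) (hi : cs.IsRightDescent w i)
    (hG : w * cs.simple i * w⁻¹ ∈ descConj cs v)
    (h₁ : IsNormalForm cs (descConj cs v) (w * cs.simple i) u₁) :
    (∃ j, cs.IsRightDescent u j ∧ u * cs.simple j * u⁻¹ = w * cs.simple i * w⁻¹) ∧
      invSet cs u₁ ⊆ invSet cs u := by
  induction hn : cs.length w using Nat.strong_induction_on generalizing w i u₁ with
  | _ n ih =>
  subst hn
  by_cases hw : u = w
  · subst hw
    exact ⟨⟨i, hi, rfl⟩, h₁.2.1.trans (invSet_mul_simple_subset cs hi)⟩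
  obtain ⟨r, hr, hrG, -⟩ := h.exists_descent hw
  have hR : ∀ k ∈ ({i, r} : Set B), cs.IsRightDescent w k := by
    rintro k (rfl | rfl) <;> assumption
  have hri : r ≠ i := fun e => hrG (e ▸ hG)
  set R : Set B := {i, r} with hRdef
  have hiR : i ∈ R := by simp [R]
  have hsi := simple_mem_parab cs hiR
  set z := w * longest cs R with hz
  obtain ⟨j, hj⟩ : ∃ j, longest cs R * cs.simple i * longest cs R = cs.simple j := by
    rw [← cs.length_eq_one_iff]
    have l1 := length_mul_longest cs (mul_mem (longest_mem cs R) hsi)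
    have l2 := length_longest_mul cs hsi
    rw [cs.length_simple] at l2
    omega
  have hwz : z * cs.simple j = w * cs.simple i * longest cs R := by
    rw [hz, ← hj]; simp only [← mul_assoc]; rw [mul_assoc w, longest_mul_self, mul_one]
  have hconj : z * cs.simple j * z⁻¹ = w * cs.simple i * w⁻¹ := by
    rw [hwz, hz]; group
  have hzw := invSet_mul_longest_subset cs hR
  rw [← hz] at hzw
  have htz := conj_simple_notMem_invSet_mul_longest cs hR hiR
  rw [← hz] at htz
  have hmem (t : W) : t ∈ invSet cs (z * cs.simple j) ↔
      t ∈ invSet cs z ∨ t = w * cs.simple i * w⁻¹ := by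
    rw [mem_invSet_mul_simple, hconj]
    by_cases ht : t = w * cs.simple i * w⁻¹
    · subst ht; simp [htz]
    · simp [ht]
  have htw : w * cs.simple i * w⁻¹ ∈ invSet cs w := (conj_simple_mem_invSet cs w i).mpr hi
  have hdz : cs.IsRightDescent (z * cs.simple j) j := by
    rw [← conj_simple_mem_invSet, hmem]
    right
    rw [← hconj]; simp [mul_assoc]
  have hw'w : invSet cs (z * cs.simple j) ⊆ invSet cs w := by
    intro t ht
    rcases (hmem t).mp ht with h1 | rfl
    · exact hzw h1
    · exact htw
  have hsame : ∀ t ∈ descConj cs v, t ∈ invSet cs w → t ∈ invSet cs (z * cs.simple j) := by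
    intro t ht htw
    rw [hmem]
    by_contra! hz'
    have h1 := conj_mem_parab_of_mem_invSet cs htw hz'.1
    have e : w * (w⁻¹ * t * w) * w⁻¹ = t := by group
    have h2 := mem_parab_of_conj_mem_descConj cs hwv hR h1 (by rwa [e])
    have h3 : {k | k ∈ R ∧ w * cs.simple k * w⁻¹ ∈ descConj cs v} ⊆ {i} := by
      rintro k ⟨rfl | rfl, h4⟩
      · rfl
      · exact absurd h4 hrG
    have h4 := parab_mono cs h3 h2
    by_cases h5 : w⁻¹ * t * w = 1
    · rw [h5] at e
      have h6 := isReflection_of_mem_invSet cs htw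
      rw [← e] at h6
      have := h6.odd_length
      simp at this
    · rw [mem_parab_singleton h4 h5] at e
      exact hz'.2 e.symm
  have hlt : cs.length (z * cs.simple j) < cs.length w := by
    refine length_lt_of_invSet_subset cs hw'w fun e => ?_
    have h1 : w * cs.simple r * w⁻¹ ∈ invSet cs (z * cs.simple j) := by
      rw [e]; exact (conj_simple_mem_invSet cs w r).mpr hr
    rcases (hmem _).mp h1 with h2 | h2
    · exact conj_simple_notMem_invSet_mul_longest cs hR (by simp [R]) h2
    · exact hrG (h2 ▸ hG)
  have hzsi : invSet cs z ⊆ invSet cs (w * cs.simple i) :=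
    invSet_mul_longest_subset_mul_simple cs hR hiR
  have hws := invSet_mul_simple_subset cs hi
  have hnf' : IsNormalForm cs (descConj cs v) (z * cs.simple j) u := by
    obtain ⟨p, hp⟩ := exists_isNormalForm cs (descConj cs v) (z * cs.simple j)
    rwa [h.unique hwv (hp.of_subset hw'w hsame)]
  have hnf₁ : IsNormalForm cs (descConj cs v) (z * cs.simple j * cs.simple j) u₁ := by
    rw [mul_assoc, cs.simple_mul_simple_self, mul_one]
    obtain ⟨p, hp⟩ := exists_isNormalForm cs (descConj cs v) z
    rwa [h₁.unique (hws.trans hwv) (hp.of_subset hzsi fun t ht htw => ?_)]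
    rcases (hmem t).mp (hsame t ht (hws htw)) with h1 | rfl
    · exact h1
    · exact absurd rfl ((mem_invSet_mul_simple_of_descent cs hi _).mp htw).2
  have e : z * cs.simple j * cs.simple j * (z * cs.simple j)⁻¹ = w * cs.simple i * w⁻¹ := by
    rw [← hconj]; simp [mul_assoc]
  have := ih _ hlt (hw'w.trans hwv) hnf' hdz (by rwa [e]) hnf₁ rfl
  rwa [e] at this

theorem IsNormalForm.mono {v w₁ w₂ u₁ u₂ : W} (h₁₂ : invSet cs w₁ ⊆ invSet cs w₂)
    (h₂v : invSet cs w₂ ⊆ invSet cs v) (h₁ : IsNormalForm cs (descConj cs v) w₁ u₁)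
    (h₂ : IsNormalForm cs (descConj cs v) w₂ u₂) : invSet cs u₁ ⊆ invSet cs u₂ := by
  induction hn : cs.length w₂ using Nat.strong_induction_on generalizing w₂ u₂ with
  | _ n ih =>
  subst hn
  by_cases hne : w₁ = w₂
  · subst hne
    rw [h₁.unique h₂v h₂]
  obtain ⟨i, hi, hs, -⟩ := exists_descent_of_invSet_subset cs h₁₂ hne
  obtain ⟨p, hp⟩ := exists_isNormalForm cs (descConj cs v) (w₂ * cs.simple i)
  have hsub := invSet_mul_simple_subset cs hi
  refine (ih _ hi hs (hsub.trans h₂v) hp rfl).trans ?_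
  by_cases hG : w₂ * cs.simple i * w₂⁻¹ ∈ descConj cs v
  · exact (h₂.descent h₂v hi hG hp).2
  · rw [h₂.unique h₂v (hp.of_subset hsub (mem_invSet_mul_simple_of_mem cs hi hG))]

end NormalForm

section LowerInterval

variable {cs}

theorem shardLE_iff {u v : W} :
    shardLE cs u v ↔ invSet cs u ⊆ invSet cs v ∧ IsNormal cs (descConj cs v) u := by
  unfold shardLE IsNormal
  nth_rw 1 [descConj]
  rw [Subgroup.closure_le]
  refine and_congr_right fun _ => ⟨fun h i hi => h ⟨i, hi, rfl⟩, ?_⟩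
  rintro h _ ⟨i, hi, rfl⟩
  exact h i hi

theorem shardLE.refl (u : W) : shardLE cs u u := ⟨subset_rfl, le_rfl⟩

theorem shardLE.trans {u v w : W} (h : shardLE cs u v) (h' : shardLE cs v w) : shardLE cs u w :=
  ⟨h.1.trans h'.1, h.2.trans h'.2⟩

variable (cs)

variable [Finite W]

variable {cs} in
theorem shardLE.antisymm {u v : W} (h : shardLE cs u v) (h' : shardLE cs v u) : u = v :=
  invSet_injective cs (h.1.antisymm h'.1)

theorem exists_le_mul_mem_parab {v w : W} (hwv : invSet cs w ⊆ invSet cs v) :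
    ∃ y ∈ parab cs {i | cs.IsRightDescent v i},
      invSet cs w ⊆ invSet cs (v * longest cs {i | cs.IsRightDescent v i} * y) ∧
      ∀ t ∈ descConj cs v,
        t ∈ invSet cs (v * longest cs {i | cs.IsRightDescent v i} * y) → t ∈ invSet cs w := by
  set I := {i | cs.IsRightDescent v i} with hI
  obtain ⟨b, a, ha, hba, hb⟩ := exists_factorization cs I (w⁻¹ * v)
  have hv : v = w * b * a := by rw [mul_assoc, ← hba]; group
  have e : v * longest cs I * (longest cs I * a⁻¹) = w * b := by
    rw [← mul_assoc, mul_assoc v, longest_mul_self, hv]; group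
  have l1 := length_eq_of_invSet_subset cs hwv
  rw [hba, hb a ha] at l1
  have l2 := cs.length_mul_le (w * b) a
  have l3 := cs.length_mul_le w b
  rw [← hv] at l2
  have hl : cs.length (w * b) = cs.length w + cs.length b := by omega
  refine ⟨longest cs I * a⁻¹, mul_mem (longest_mem cs I) (inv_mem ha), ?_, ?_⟩
  · rw [e]
    exact (length_mul_eq_iff cs w b).mp hl
  · rw [e]
    intro t ht h
    refine ((mem_invSet_mul_of_length cs hl t).mp h).resolve_right ?_
    refine (isMinRep_of_length_mul cs hb).conj_notMem_invSet cs ?_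
    rw [mem_descConj_iff, ← hI] at ht
    have e' : b⁻¹ * (w⁻¹ * t * w) * b = a * (v⁻¹ * t * v) * a⁻¹ := by rw [hv]; group
    rw [e']
    exact mul_mem (mul_mem ha ht) (inv_mem ha)

theorem isMinRep_mul_longest_descents (v : W) :
    IsMinRep cs {i | cs.IsRightDescent v i} (v * longest cs {i | cs.IsRightDescent v i}) :=
  (isMinRep_mul_longest_iff cs).mpr fun _ h => h

theorem mem_descConj_iff_mul_longest (v t : W) : t ∈ descConj cs v ↔
    (v * longest cs {i | cs.IsRightDescent v i})⁻¹ * t *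
      (v * longest cs {i | cs.IsRightDescent v i}) ∈ parab cs {i | cs.IsRightDescent v i} := by
  rw [mem_descConj_iff]
  set I := {i | cs.IsRightDescent v i}
  have e : (v * longest cs I)⁻¹ * t * (v * longest cs I)
      = (longest cs I)⁻¹ * (v⁻¹ * t * v) * longest cs I := by group
  rw [e, Subgroup.mul_mem_cancel_right _ (longest_mem cs I),
    Subgroup.mul_mem_cancel_left _ (inv_mem (longest_mem cs I))]

/-- The interval below `v` in the shard order is isomorphic to the shard order on the
parabolic subgroup generated by the right descents of `v`. -/
theorem exists_shardLE_embedding (v : W) :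
    ∃ ψ : W → W, (∀ y ∈ parab cs {i | cs.IsRightDescent v i}, shardLE cs (ψ y) v) ∧
      (∀ u, shardLE cs u v → ∃ y ∈ parab cs {i | cs.IsRightDescent v i}, ψ y = u) ∧
      ∀ y ∈ parab cs {i | cs.IsRightDescent v i}, ∀ y' ∈ parab cs {i | cs.IsRightDescent v i},
        (shardLE cs (ψ y) (ψ y') ↔ shardLE cs y y') := by
  have hx := isMinRep_mul_longest_descents cs v
  have hG := mem_descConj_iff_mul_longest cs v
  have htop := fun w => exists_le_mul_mem_parab cs (v := v) (w := w)
  have hxv : v * longest cs {i | cs.IsRightDescent v i} * longest cs {i | cs.IsRightDescent v i}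
    = v := by rw [mul_assoc, longest_mul_self, mul_one]
  set I := {i | cs.IsRightDescent v i}
  set x := v * longest cs I
  have hinv {y : W} (hy : y ∈ parab cs I) (t : W) :
      t ∈ invSet cs (x * y) ↔ t ∈ invSet cs x ∨ x⁻¹ * t * x ∈ invSet cs y :=
    mem_invSet_mul_of_length cs (hx.length_mul cs hy) t
  have hmono {y y' : W} (hy : y ∈ parab cs I) (hy' : y' ∈ parab cs I)
      (h : invSet cs y ⊆ invSet cs y') : invSet cs (x * y) ⊆ invSet cs (x * y') := by
    intro t
    rw [hinv hy, hinv hy']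
    exact Or.imp_right fun ht => h ht
  have hle {y : W} (hy : y ∈ parab cs I) : invSet cs (x * y) ⊆ invSet cs v := by
    have := hmono hy (longest_mem cs I) (invSet_subset_longest cs hy)
    rwa [hxv] at this
  have hinvG {y t : W} (hy : y ∈ parab cs I) (ht : t ∈ descConj cs v) :
      t ∈ invSet cs (x * y) ↔ x⁻¹ * t * x ∈ invSet cs y := by
    rw [hinv hy, or_iff_right]
    exact hx.conj_notMem_invSet cs ((hG t).mp ht)
  choose ψ hψ using fun y => exists_isNormalForm cs (descConj cs v) (x * y)
  have hψv {y : W} (hy : y ∈ parab cs I) : invSet cs (ψ y) ⊆ invSet cs v :=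
    (hψ y).2.1.trans (hle hy)
  have hψG {y t : W} (hy : y ∈ parab cs I) (ht : t ∈ descConj cs v) :
      t ∈ invSet cs (ψ y) ↔ x⁻¹ * t * x ∈ invSet cs y :=
    ⟨fun h => (hinvG hy ht).mp ((hψ y).2.1 h), fun h => (hψ y).2.2 t ht ((hinvG hy ht).mpr h)⟩
  have hconjG {τ : W} (hτ : τ ∈ parab cs I) : x * τ * x⁻¹ ∈ descConj cs v := by
    rw [hG]; convert hτ using 1; group
  have hord {y y' : W} (hy : y ∈ parab cs I) (hy' : y' ∈ parab cs I) :
      invSet cs (ψ y) ⊆ invSet cs (ψ y') ↔ invSet cs y ⊆ invSet cs y' := by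
    refine ⟨fun h τ hτ => ?_, fun h => (hψ y).mono (hmono hy hy' h) (hle hy') (hψ y')⟩
    have hτG := hconjG (invSet_subset_parab cs hy hτ)
    have e : x⁻¹ * (x * τ * x⁻¹) * x = τ := by group
    have h1 := (hψG hy hτG).mpr (by rwa [e])
    have h2 := (hψG hy' hτG).mp (h h1)
    rwa [e] at h2
  have hdesc {y : W} (hy : y ∈ parab cs I) :
      descConj cs (ψ y) = (descConj cs y).map (MulAut.conj x).toMonoidHom := by
    unfold descConj
    rw [MonoidHom.map_closure]
    congr 1
    ext t
    simp only [Set.mem_ofPred_eq, Set.mem_image, MulEquiv.coe_toMonoidHom, MulAut.conj_apply]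
    constructor
    · rintro ⟨i, hi, rfl⟩
      have htG := (hψ y).1 i hi
      obtain ⟨y₁, hy₁, hle₁, hG₁⟩ := htop _ ((invSet_mul_simple_subset cs hi).trans (hψv hy))
      set t := ψ y * cs.simple i * (ψ y)⁻¹ with ht
      have ht0 : x⁻¹ * t * x ∈ invSet cs y :=
        (hψG hy htG).mp ((conj_simple_mem_invSet cs _ i).mpr hi)
      have key {τ : W} (hτ : τ ∈ parab cs I) :
          τ ∈ invSet cs y₁ ↔ τ ∈ invSet cs y ∧ τ ≠ x⁻¹ * t * x := by
        have hτG := hconjG hτ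
        have e : x⁻¹ * (x * τ * x⁻¹) * x = τ := by group
        have k1 := hinvG hy₁ hτG
        have k2 := hψG hy hτG
        rw [e] at k1 k2
        rw [← k1, ← k2]
        have k3 : τ = x⁻¹ * t * x ↔ x * τ * x⁻¹ = t :=
          ⟨fun h => by rw [h]; group, fun h => by rw [← h]; group⟩
        rw [ne_eq, k3, ← ne_eq, ← mem_invSet_mul_simple_of_descent cs hi]
        exact ⟨hG₁ _ hτG, fun h => hle₁ h⟩
      have hsub : invSet cs y₁ ⊆ invSet cs y := fun τ hτ =>
        ((key (invSet_subset_parab cs hy₁ hτ)).mp hτ).1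
      have hne : y₁ ≠ y := by
        rintro rfl
        exact ((key (invSet_subset_parab cs hy ht0)).mp ht0).2 rfl
      obtain ⟨j, hj, -, hn⟩ := exists_descent_of_invSet_subset cs hsub hne
      have hj' := (conj_simple_mem_invSet cs y j).mpr hj
      refine ⟨_, ⟨j, hj, rfl⟩, ?_⟩
      rw [key (invSet_subset_parab cs hy hj')] at hn
      have : y * cs.simple j * y⁻¹ = x⁻¹ * t * x := by tauto
      rw [this]; group
    · rintro ⟨_, ⟨j, hj, rfl⟩, rfl⟩
      have hj' := invSet_subset_parab cs hy ((conj_simple_mem_invSet cs y j).mpr hj)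
      have hys := mem_parab_of_invSet_subset cs
        ((invSet_mul_simple_subset cs hj).trans (invSet_subset_parab cs hy))
      have hd : cs.IsRightDescent (x * y) j := by
        unfold CoxeterSystem.IsRightDescent at hj ⊢
        rw [mul_assoc, hx.length_mul cs hys, hx.length_mul cs hy]
        omega
      have e : x * y * cs.simple j * (x * y)⁻¹ = x * (y * cs.simple j * y⁻¹) * x⁻¹ := by group
      obtain ⟨u₁, hu₁⟩ := exists_isNormalForm cs (descConj cs v) (x * y * cs.simple j)
      obtain ⟨⟨i, hi, hij⟩, -⟩ :=
        (hψ y).descent (hle hy) hd (by rw [e]; exact hconjG hj') hu₁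
      exact ⟨i, hi, by rw [hij, e]⟩
  refine ⟨ψ, fun y hy => shardLE_iff.mpr ⟨hψv hy, (hψ y).1⟩, fun u hu => ?_, ?_⟩
  · obtain ⟨huv, hun⟩ := shardLE_iff.mp hu
    obtain ⟨y, hy, h1, h2⟩ := htop u huv
    exact ⟨y, hy, (hψ y).unique (hle hy) ⟨hun, h1, h2⟩⟩
  · intro y hy y' hy'
    unfold shardLE
    rw [hord hy hy', hdesc hy, hdesc hy', Subgroup.map_le_map_iff_of_injective]
    exact (MulAut.conj x).injective

end LowerInterval

section ChainCount

variable {α : Type*} [Fintype α]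

/-- The number of strict chains with `n + 1` elements and top element `v`. -/
noncomputable def chainCount (R : α → α → Prop) : ℕ → α → ℕ
  | 0, _ => 1
  | n + 1, v => ∑ u with R u v ∧ u ≠ v, chainCount R n u

theorem sum_chainCount {R : α → α → Prop} (hrefl : ∀ a, R a a) (n : ℕ) (v : α) :
    ∑ u with R u v, chainCount R n u = chainCount R (n + 1) v + chainCount R n v := by
  have h : (Finset.univ.filter fun u => R u v)
      = insert v (Finset.univ.filter fun u => R u v ∧ u ≠ v) := by
    ext u
    by_cases huv : u = v
    · subst huv; simp [hrefl]
    · simp [huv]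
  rw [h, Finset.sum_insert (by simp), add_comm]
  rfl

/-- Splitting off the top element of a strict chain. -/
def chainSnocEquiv {R : α → α → Prop} (htrans : ∀ a b c, R a b → R b c → R a c)
    (P : α → Prop) (n : ℕ) :
    {c : Fin (n + 2) → α // (∀ i j, i < j → R (c i) (c j)) ∧ P (c (Fin.last (n + 1)))} ≃
      Σ v : {v // P v}, {c : Fin (n + 1) → α //
        (∀ i j, i < j → R (c i) (c j)) ∧ R (c (Fin.last n)) v} where
  toFun c := ⟨⟨c.1 (Fin.last _), c.2.2⟩, fun i => c.1 i.castSucc,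
    fun i j h => c.2.1 _ _ (Fin.castSucc_lt_castSucc_iff.mpr h),
    c.2.1 _ _ (Fin.castSucc_lt_last _)⟩
  invFun p := ⟨Fin.snoc (α := fun _ => α) p.2.1 p.1.1, by
    obtain ⟨⟨v, hv⟩, c, hc, hcv⟩ := p
    refine ⟨fun i j h => ?_, by simpa using hv⟩
    induction j using Fin.lastCases with
    | last =>
      induction i using Fin.lastCases with
      | last => exact absurd h (lt_irrefl _)
      | cast i =>
        simp only [Fin.snoc_castSucc, Fin.snoc_last]
        rcases (Fin.le_last i).lt_or_eq with hi | rfl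
        · exact htrans _ _ _ (hc _ _ hi) hcv
        · exact hcv
    | cast j =>
      induction i using Fin.lastCases with
      | last => exact absurd (h.trans (Fin.castSucc_lt_last j)) (lt_irrefl _)
      | cast i =>
        simp only [Fin.snoc_castSucc]
        exact hc _ _ (Fin.castSucc_lt_castSucc_iff.mp h)⟩
  left_inv c := by
    apply Subtype.ext
    exact Fin.snoc_init_self c.1
  right_inv p := by
    refine Sigma.subtype_ext (Subtype.ext ?_) (funext fun i => ?_)
    · simp
    · simp

theorem card_strictChains {R : α → α → Prop} (htrans : ∀ a b c, R a b → R b c → R a c)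
    (hanti : ∀ a b, R a b → R b a → a = b) (P : α → Prop) (n : ℕ) :
    Nat.card {c : Fin (n + 1) → α // (∀ i j, i < j → R (c i) (c j) ∧ c i ≠ c j) ∧
      P (c (Fin.last n))} = ∑ v with P v, chainCount R n v := by
  have hs : ∀ a b c, (R a b ∧ a ≠ b) → (R b c ∧ b ≠ c) → (R a c ∧ a ≠ c) := by
    rintro a b c ⟨h1, h2⟩ ⟨h3, -⟩
    refine ⟨htrans _ _ _ h1 h3, ?_⟩
    rintro rfl
    exact h2 (hanti _ _ h1 h3)
  induction n generalizing P with
  | zero =>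
    have e : {c : Fin (0 + 1) → α // (∀ i j, i < j → R (c i) (c j) ∧ c i ≠ c j) ∧
        P (c (Fin.last 0))} ≃ {v // P v} :=
      (Equiv.funUnique (Fin 1) α).subtypeEquiv fun c => by
        rw [and_iff_right fun i j h => absurd h (by simp)]
        rfl
    rw [Nat.card_congr e, Nat.card_eq_fintype_card, Fintype.card_subtype]
    simp [chainCount]
  | succ n ih =>
    rw [Nat.card_congr (chainSnocEquiv (R := fun a b => R a b ∧ a ≠ b) hs P n), Nat.card_sigma]
    rw [Finset.sum_congr rfl fun v _ => ih fun u => R u v.1 ∧ u ≠ v.1]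
    rw [Finset.sum_subtype (Finset.univ.filter P) (p := P) (by simp)]
    refine Finset.sum_congr rfl fun v _ => ?_
    rw [chainCount]
    exact Finset.sum_congr (by ext; simp) fun _ _ => rfl

end ChainCount

section BHZ

variable {cs}

theorem bhzLE_iff [Finite W] {u v : W} :
    bhzLE cs u v ↔ IsMinRep cs (supp cs u) (v * u⁻¹) := by
  refine ⟨fun h => h.2.1, fun h => ⟨mem_parab_supp cs u, h, ?_⟩⟩
  simpa using h.length_mul cs (mem_parab_supp cs u)

theorem bhzLE.refl (u : W) : bhzLE cs u u := by
  refine ⟨mem_parab_supp cs u, fun i _ h => ?_, by simp⟩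
  simp [CoxeterSystem.IsRightDescent] at h

theorem bhzLE.antisymm {u v : W} (h : bhzLE cs u v) (h' : bhzLE cs v u) : u = v := by
  have h1 : cs.length (v * u⁻¹) = 0 := by
    have := h.2.2
    have := h'.2.2
    omega
  rw [cs.length_eq_zero_iff, mul_inv_eq_one] at h1
  exact h1.symm

theorem bhzLE.supp_eq [Finite W] {u v : W} (h : bhzLE cs u v) :
    supp cs v = supp cs (v * u⁻¹) ∪ supp cs u := by
  rw [← supp_mul cs (by simpa using h.2.2), inv_mul_cancel_right]

theorem bhzLE.trans [Finite W] {u v w : W} (h : bhzLE cs u v) (h' : bhzLE cs v w) :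
    bhzLE cs u w := by
  rw [bhzLE_iff]
  intro i hi hd
  have hmem := parab_mono cs (h.supp_eq ▸ Set.subset_union_left) (mem_parab_supp cs (v * u⁻¹))
  have hsi : cs.simple i ∈ parab cs (supp cs v) :=
    simple_mem_parab cs (h.supp_eq ▸ Set.subset_union_right hi)
  refine h.2.1 i hi ?_
  have e : w * u⁻¹ = w * v⁻¹ * (v * u⁻¹) := by group
  unfold CoxeterSystem.IsRightDescent at hd ⊢
  rw [e, mul_assoc (w * v⁻¹), h'.2.1.length_mul cs (mul_mem hmem hsi),
    h'.2.1.length_mul cs hmem] at hd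
  omega

end BHZ

section Counting

theorem sum_filter_sum_filter {α β : Type*} [Fintype α] [Fintype β] (P : α → Prop)
    (Q : β → α → Prop) (f : β → ℕ) :
    ∑ a with P a, ∑ b with Q b a, f b =
      ∑ b, f b * (Finset.univ.filter fun a => P a ∧ Q b a).card := by
  rw [Finset.sum_comm' (s' := fun b => Finset.univ.filter fun a => P a ∧ Q b a)
    (t' := Finset.univ) (by simp)]
  simp [mul_comm]

variable [Fintype W]

/-- The number of minimal coset representatives `x` for `W_K` with `S(x) ∪ K = J`. -/
noncomputable def minRepCount (K J : Set B) : ℕ :=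
  (Finset.univ.filter fun x : W => IsMinRep cs K x ∧ supp cs x ∪ K = J).card

theorem card_supp_eq_bhzLE (u : W) (J : Set B) :
    (Finset.univ.filter fun v : W => supp cs v = J ∧ bhzLE cs u v).card =
      minRepCount cs (supp cs u) J := by
  refine Finset.card_equiv (Equiv.mulRight u⁻¹) fun v => ?_
  simp only [Finset.mem_filter_univ, Equiv.coe_mulRight, ← bhzLE_iff]
  rw [and_comm]
  exact and_congr_right fun h => by rw [h.supp_eq]

theorem card_supp_eq_descents {K : Set B} (hK : IsSaturated cs K) (J : Set B) :
    (Finset.univ.filter fun v : W => supp cs v = J ∧ K ⊆ {i | cs.IsRightDescent v i}).card =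
      minRepCount cs K J := by
  refine Finset.card_equiv (Equiv.mulRight (longest cs K)) fun v => ?_
  simp only [Finset.mem_filter_univ, Equiv.coe_mulRight, isMinRep_mul_longest_iff]
  rw [and_comm]
  refine and_congr_right fun h => ?_
  have := supp_mul cs
    (((isMinRep_mul_longest_iff cs).mpr h).length_mul cs (longest_mem cs K))
  rw [mul_assoc, longest_mul_self, mul_one, supp_longest cs hK] at this
  rw [this]

theorem chainCount_shardLE_embedding {v : W} {ψ : W → W}
    (hψ : ∀ y ∈ parab cs {i | cs.IsRightDescent v i}, shardLE cs (ψ y) v)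
    (hsurj : ∀ u, shardLE cs u v → ∃ y ∈ parab cs {i | cs.IsRightDescent v i}, ψ y = u)
    (hle : ∀ y ∈ parab cs {i | cs.IsRightDescent v i},
      ∀ y' ∈ parab cs {i | cs.IsRightDescent v i},
        (shardLE cs (ψ y) (ψ y') ↔ shardLE cs y y')) (n : ℕ) {y : W}
    (hy : y ∈ parab cs {i | cs.IsRightDescent v i}) :
    chainCount (shardLE cs) n (ψ y) = chainCount (shardLE cs) n y := by
  have hinj : ∀ y ∈ parab cs {i | cs.IsRightDescent v i},
      ∀ y' ∈ parab cs {i | cs.IsRightDescent v i}, ψ y = ψ y' → y = y' := by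
    intro y hy y' hy' h
    exact shardLE.antisymm ((hle y hy y' hy').mp (h ▸ shardLE.refl _))
      ((hle y' hy' y hy).mp (h ▸ shardLE.refl _))
  have hlower {y y' : W} (hy : y ∈ parab cs {i | cs.IsRightDescent v i})
      (h : shardLE cs y' y) : y' ∈ parab cs {i | cs.IsRightDescent v i} :=
    mem_parab_of_invSet_subset cs (h.1.trans (invSet_subset_parab cs hy))
  induction n generalizing y with
  | zero => rfl
  | succ n ih =>
    rw [chainCount, chainCount]
    refine (Finset.sum_bij (fun y' _ => ψ y') ?_ ?_ ?_ ?_).symm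
    · simp only [Finset.mem_filter_univ]
      rintro y' ⟨h, hne⟩
      have hy' := hlower hy h
      exact ⟨(hle _ hy' _ hy).mpr h, fun e => hne (hinj _ hy' _ hy e)⟩
    · simp only [Finset.mem_filter_univ]
      rintro y₁ ⟨h₁, -⟩ y₂ ⟨h₂, -⟩ e
      exact hinj _ (hlower hy h₁) _ (hlower hy h₂) e
    · simp only [Finset.mem_filter_univ]
      rintro u ⟨h, hne⟩
      obtain ⟨y', hy', rfl⟩ := hsurj u (h.trans (hψ y hy))
      exact ⟨y', ⟨(hle _ hy' _ hy).mp h, fun e => hne (e ▸ rfl)⟩, rfl⟩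
    · simp only [Finset.mem_filter_univ]
      rintro y' ⟨h, -⟩
      exact (ih (hlower hy h)).symm

theorem sum_chainCount_shardLE_le (n : ℕ) (v : W) :
    ∑ u with shardLE cs u v, chainCount (shardLE cs) n u =
      ∑ y with supp cs y ⊆ {i | cs.IsRightDescent v i}, chainCount (shardLE cs) n y := by
  obtain ⟨ψ, hψ, hsurj, hle⟩ := exists_shardLE_embedding cs v
  simp only [← mem_parab_iff cs (isSaturated_descents cs v)]
  refine (Finset.sum_bij (fun y _ => ψ y) ?_ ?_ ?_ ?_).symm
  · simpa only [Finset.mem_filter_univ] using hψ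
  · simp only [Finset.mem_filter_univ]
    intro y hy y' hy' h
    exact shardLE.antisymm ((hle y hy y' hy').mp (h ▸ shardLE.refl _))
      ((hle y' hy' y hy).mp (h ▸ shardLE.refl _))
  · simpa only [Finset.mem_filter_univ, exists_prop] using hsurj
  · simp only [Finset.mem_filter_univ]
    exact fun y hy => (chainCount_shardLE_embedding cs hψ hsurj hle n hy).symm

theorem sum_mul_eq_of_sum_supp_eq {f g : W → ℕ}
    (h : ∀ J, ∑ v with supp cs v = J, f v = ∑ v with supp cs v = J, g v) (a : Set B → ℕ) :
    ∑ u, f u * a (supp cs u) = ∑ u, g u * a (supp cs u) := by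
  have key (f : W → ℕ) : ∑ u, f u * a (supp cs u) =
      ∑ J ∈ Finset.univ.image (supp cs), (∑ v with supp cs v = J, f v) * a J := by
    rw [← Finset.sum_fiberwise_of_maps_to (s := Finset.univ) (t := Finset.univ.image (supp cs))
      (g := supp cs) fun u _ => Finset.mem_image_of_mem _ (Finset.mem_univ u)]
    refine Finset.sum_congr rfl fun J _ => ?_
    rw [Finset.sum_mul]
    refine Finset.sum_congr rfl fun u hu => ?_
    rw [(Finset.mem_filter.mp hu).2]
  rw [key f, key g]
  exact Finset.sum_congr rfl fun J _ => by rw [h]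

theorem sum_chainCount_supp_eq (n : ℕ) (J : Set B) :
    ∑ v with supp cs v = J, chainCount (shardLE cs) n v =
      ∑ v with supp cs v = J, chainCount (bhzLE cs) n v := by
  induction n generalizing J with
  | zero => rfl
  | succ n ih =>
    have hσ : ∑ v with supp cs v = J, ∑ u with shardLE cs u v, chainCount (shardLE cs) n u =
        ∑ u, chainCount (shardLE cs) n u * minRepCount cs (supp cs u) J := by
      simp only [sum_chainCount_shardLE_le, ← card_supp_eq_descents cs (isSaturated_supp cs _)]
      exact sum_filter_sum_filter _ _ _
    have hβ : ∑ v with supp cs v = J, ∑ u with bhzLE cs u v, chainCount (bhzLE cs) n u =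
        ∑ u, chainCount (bhzLE cs) n u * minRepCount cs (supp cs u) J := by
      simp only [← card_supp_eq_bhzLE]
      exact sum_filter_sum_filter _ _ _
    simp only [sum_chainCount shardLE.refl, sum_chainCount bhzLE.refl,
      Finset.sum_add_distrib] at hσ hβ
    have := sum_mul_eq_of_sum_supp_eq cs ih fun K => minRepCount cs K J
    have := ih J
    omega

end Counting

/-- For every subset `J` of the simple reflections and every `k ≥ 1`, the number of
strict `k`-chains whose top element has support `J` is the same for the shard order
and the BHZ order. -/
theorem strict_chains_top_supp_card_eq [Finite W] (J : Set B) (k : ℕ) (hk : 1 ≤ k) :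
    Nat.card {c : Fin k → W //
        (∀ i j : Fin k, i < j → shardLE cs (c i) (c j) ∧ c i ≠ c j) ∧
        supp cs (c ⟨k - 1, by omega⟩) = J} =
      Nat.card {c : Fin k → W //
        (∀ i j : Fin k, i < j → bhzLE cs (c i) (c j) ∧ c i ≠ c j) ∧
        supp cs (c ⟨k - 1, by omega⟩) = J} := by
  obtain ⟨n, rfl⟩ : ∃ n, k = n + 1 := ⟨k - 1, by omega⟩
  have := Fintype.ofFinite W
  have hσ := card_strictChains (R := shardLE cs) (fun _ _ _ => shardLE.trans)
    (fun _ _ => shardLE.antisymm) (fun v => supp cs v = J) n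
  have hβ := card_strictChains (R := bhzLE cs) (fun _ _ _ => bhzLE.trans)
    (fun _ _ => bhzLE.antisymm) (fun v => supp cs v = J) n
  exact hσ.trans ((sum_chainCount_supp_eq cs n J).trans hβ.symm)

end ShardBHZ
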